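/- arXiv:2009.00241 — 3 statements merged into one kernel-verified Lean document; each statement's English description precedes it below -/
import Mathlib

section
/- For all strictly positive operators U, V on a complex Hilbert space H, ln V − ln U = ∫₀^∞ [ (λ + U)⁻¹ − (λ + V)⁻¹ ] dλ, where ln U, ln V are defined by the continuous functional calculus and λ + T abbreviates λ·I + T. -/
open MeasureTheory

variable {H : Type*} [NormedAddCommGroup H] [InnerProductSpace ℂ H] [CompleteSpace H]

/-- An operator `T` on a complex Hilbert space is *strictly positive* if
`⟪T x, x⟫ ≥ 0` for all `x` and `T` is invertible. -/
def StrictlyPos (T : H →L[ℂ] H) : Prop := T.IsPositive ∧ IsUnit T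

/-- `A^{1/2}` via the continuous functional calculus. -/
noncomputable def opSqrt (A : H →L[ℂ] H) : H →L[ℂ] H := cfc Real.sqrt A

/-- `A^{-1/2}` via the continuous functional calculus. -/
noncomputable def opInvSqrt (A : H →L[ℂ] H) : H →L[ℂ] H :=
  cfc (fun x : ℝ => (Real.sqrt x)⁻¹) A

/-- The noncommutative perspective `𝒫_f(B, A) := A^{1/2} f(A^{-1/2} B A^{-1/2}) A^{1/2}`. -/
noncomputable def persp (f : ℝ → ℝ) (B A : H →L[ℂ] H) : H →L[ℂ] H :=
  opSqrt A * cfc f (opInvSqrt A * B * opInvSqrt A) * opSqrt A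

/-- The weighted operator geometric mean `A ♯_ν B := A^{1/2} (A^{-1/2} B A^{-1/2})^ν A^{1/2}`. -/
noncomputable def gmean (ν : ℝ) (A B : H →L[ℂ] H) : H →L[ℂ] H :=
  opSqrt A * cfc (fun x : ℝ => x ^ ν) (opInvSqrt A * B * opInvSqrt A) * opSqrt A

/-- The relative operator entropy `S(A|B) := A^{1/2} ln(A^{-1/2} B A^{-1/2}) A^{1/2}`. -/
noncomputable def relEntropy (A B : H →L[ℂ] H) : H →L[ℂ] H :=
  opSqrt A * cfc Real.log (opInvSqrt A * B * opInvSqrt A) * opSqrt A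

/-- On `[m, M]` the integrand representing the logarithm is dominated by a multiple of
`(l + 1) ^ (-2)`. -/
theorem norm_inv_sub_inv_le {m M l x : ℝ} (hm : 0 < m) (hm1 : m ≤ 1) (hl : 0 < l)
    (hmx : m ≤ x) (hxM : x ≤ M) :
    ‖(l + 1)⁻¹ - (l + x)⁻¹‖ ≤ (M + 1) / m * (l + 1) ^ (-2 : ℝ) := by
  have hx : 0 < x := hm.trans_le hmx
  have h1 : 0 < l + 1 := by positivity
  have h2 : 0 < l + x := by positivity
  have h3 : m * (l + 1) ≤ l + x := by nlinarith
  have hpow : (l + 1) ^ (-2 : ℝ) = ((l + 1) ^ 2)⁻¹ := by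
    rw [Real.rpow_neg h1.le, Real.rpow_two]
  have heq : (l + 1)⁻¹ - (l + x)⁻¹ = (x - 1) / ((l + 1) * (l + x)) := by
    field_simp
    ring
  have hbd : (M + 1) / m * ((l + 1) ^ 2)⁻¹ = (M + 1) / ((l + 1) * (m * (l + 1))) := by
    field_simp
  rw [hpow, heq, hbd, Real.norm_eq_abs, abs_div, abs_of_pos (mul_pos h1 h2)]
  gcongr
  · linarith
  · exact abs_le.2 ⟨by linarith, by linarith⟩

theorem integrableOn_const_mul_add_one_rpow (c : ℝ) :
    IntegrableOn (fun l : ℝ => c * (l + 1) ^ (-2 : ℝ)) (Set.Ioi 0) :=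
  (integrableOn_add_rpow_Ioi_of_lt (by norm_num) (by norm_num)).const_mul c

theorem continuousOn_inv_sub_inv {s : Set ℝ} (hs : ∀ x ∈ s, 0 < x) :
    ContinuousOn (Function.uncurry fun l x : ℝ => (l + 1)⁻¹ - (l + x)⁻¹) (Set.Ioi 0 ×ˢ s) := by
  refine ContinuousOn.sub (ContinuousOn.inv₀ (by fun_prop) ?_) (ContinuousOn.inv₀ (by fun_prop) ?_)
  · rintro ⟨l, x⟩ ⟨hl, -⟩
    have : 0 < l := hl
    dsimp only
    positivity
  · rintro ⟨l, x⟩ ⟨hl, hx⟩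
    have : 0 < l := hl
    have := hs x hx
    dsimp only at *
    positivity

/-- The scalar integral representation of the logarithm. -/
theorem integral_inv_sub_inv_eq_log {x : ℝ} (hx : 0 < x) :
    ∫ l in Set.Ioi (0 : ℝ), ((l + 1)⁻¹ - (l + x)⁻¹) = Real.log x := by
  have hint : IntegrableOn (fun l : ℝ => (l + 1)⁻¹ - (l + x)⁻¹) (Set.Ioi 0) := by
    refine (integrableOn_const_mul_add_one_rpow ((x + 1) / min x 1)).mono' ?_ ?_
    · refine ContinuousOn.aestronglyMeasurable ?_ measurableSet_Ioi
      exact (continuousOn_inv_sub_inv (s := {x}) (by simpa using hx)).comp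
        (f := fun l : ℝ => (l, x)) (by fun_prop) fun l hl => ⟨hl, rfl⟩
    · exact ae_restrict_of_forall_mem measurableSet_Ioi fun l hl =>
        norm_inv_sub_inv_le (lt_min hx one_pos) (min_le_right _ _) hl (min_le_left _ _) le_rfl
  have hderiv : ∀ l ∈ Set.Ici (0 : ℝ), HasDerivAt (fun l => Real.log (l + 1) - Real.log (l + x))
      ((l + 1)⁻¹ - (l + x)⁻¹) l := by
    intro l hl
    have hl' : 0 ≤ l := hl
    have h1 := ((hasDerivAt_id l).add_const 1).log (by simp only [id]; positivity)
    have h2 := ((hasDerivAt_id l).add_const x).log (by simp only [id]; positivity)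
    simpa only [id, one_div] using h1.fun_sub h2
  have hlim : Filter.Tendsto (fun l => Real.log (l + 1) - Real.log (l + x)) Filter.atTop
      (nhds 0) := by
    have h := (Real.tendsto_log_comp_add_sub_log 1).sub (Real.tendsto_log_comp_add_sub_log x)
    simpa using h
  rw [integral_Ioi_of_hasDerivAt_of_tendsto' hderiv hint hlim]
  simp

namespace StrictlyPos

variable {T : H →L[ℂ] H}

theorem isSelfAdjoint (hT : StrictlyPos T) : IsSelfAdjoint T := hT.1.isSelfAdjoint

theorem spectrum_pos (hT : StrictlyPos T) {x : ℝ} (hx : x ∈ spectrum ℝ T) : 0 < x := by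
  have h0 : 0 ≤ T := (ContinuousLinearMap.nonneg_iff_isPositive T).2 hT.1
  refine (spectrum_nonneg_of_nonneg h0 hx).lt_of_ne ?_
  rintro rfl
  exact spectrum.zero_notMem ℝ hT.2 hx

theorem exists_spectrum_bounds (hT : StrictlyPos T) :
    ∃ m M : ℝ, 0 < m ∧ m ≤ 1 ∧ ∀ x ∈ spectrum ℝ T, m ≤ x ∧ x ≤ M := by
  have hc : IsCompact (spectrum ℝ T) := spectrum.isCompact T
  obtain ⟨M, hM⟩ := hc.bddAbove
  obtain he | hne := (spectrum ℝ T).eq_empty_or_nonempty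
  · exact ⟨1, 1, one_pos, le_rfl, by simp [he]⟩
  · obtain ⟨m, hm⟩ := hc.exists_isLeast hne
    exact ⟨min m 1, M, lt_min (hT.spectrum_pos hm.1) one_pos, min_le_right _ _,
      fun x hx => ⟨(min_le_left _ _).trans (hm.2 hx), hM hx⟩⟩

theorem cfc_inv_sub_inv (hT : StrictlyPos T) {l : ℝ} (hl : 0 < l) :
    cfc (fun x : ℝ => (l + 1)⁻¹ - (l + x)⁻¹) T =
      algebraMap ℝ (H →L[ℂ] H) (l + 1)⁻¹ - Ring.inverse (l • 1 + T) := by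
  have ha : IsSelfAdjoint T := hT.isSelfAdjoint
  have hne : ∀ x ∈ spectrum ℝ T, l + x ≠ 0 := fun x hx =>
    (add_pos hl (hT.spectrum_pos hx)).ne'
  rw [cfc_sub (fun _ : ℝ => (l + 1)⁻¹) (fun x => (l + x)⁻¹) T (by fun_prop)
      (ContinuousOn.inv₀ (by fun_prop) hne), cfc_const _ T, cfc_inv _ T hne,
    cfc_const_add l (fun x : ℝ => x) T, cfc_id' ℝ T, Algebra.algebraMap_eq_smul_one l]

theorem integrableOn_algebraMap_sub_inverse (hT : StrictlyPos T) :
    IntegrableOn (fun l : ℝ =>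
      algebraMap ℝ (H →L[ℂ] H) (l + 1)⁻¹ - Ring.inverse (l • 1 + T)) (Set.Ioi 0) := by
  obtain ⟨m, M, hm, hm1, hmM⟩ := hT.exists_spectrum_bounds
  have hI := integrableOn_cfc (μ := volume) measurableSet_Ioi
    (fun l x : ℝ => (l + 1)⁻¹ - (l + x)⁻¹) _ T
    (continuousOn_inv_sub_inv fun x hx => hT.spectrum_pos hx)
    (ae_restrict_of_forall_mem measurableSet_Ioi fun l hl x hx =>
      norm_inv_sub_inv_le hm hm1 hl (hmM x hx).1 (hmM x hx).2)
    (integrableOn_const_mul_add_one_rpow _).2 hT.isSelfAdjoint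
  exact hI.congr_fun (fun l hl => hT.cfc_inv_sub_inv hl) measurableSet_Ioi

/-- The integral representation of the logarithm of a strictly positive operator. -/
theorem cfc_log_eq_integral (hT : StrictlyPos T) :
    cfc Real.log T = ∫ l in Set.Ioi (0 : ℝ),
      (algebraMap ℝ (H →L[ℂ] H) (l + 1)⁻¹ - Ring.inverse (l • 1 + T)) := by
  obtain ⟨m, M, hm, hm1, hmM⟩ := hT.exists_spectrum_bounds
  have hI := cfc_setIntegral (μ := volume) measurableSet_Ioi
    (fun l x : ℝ => (l + 1)⁻¹ - (l + x)⁻¹) _ T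
    (continuousOn_inv_sub_inv fun x hx => hT.spectrum_pos hx)
    (ae_restrict_of_forall_mem measurableSet_Ioi fun l hl x hx =>
      norm_inv_sub_inv_le hm hm1 hl (hmM x hx).1 (hmM x hx).2)
    (integrableOn_const_mul_add_one_rpow _).2 hT.isSelfAdjoint
  rw [← setIntegral_congr_fun measurableSet_Ioi (fun l hl => hT.cfc_inv_sub_inv hl), ← hI]
  exact cfc_congr fun x hx => (integral_inv_sub_inv_eq_log (hT.spectrum_pos hx)).symm

end StrictlyPos

/-- **(2.22).** For all strictly positive operators `U, V`,
`ln V - ln U = ∫₀^∞ [(λ + U)⁻¹ - (λ + V)⁻¹] dλ`. -/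
theorem stmt_15 (U V : H →L[ℂ] H) (hU : StrictlyPos U) (hV : StrictlyPos V) :
    cfc Real.log V - cfc Real.log U =
      ∫ l in Set.Ioi (0:ℝ), (Ring.inverse (l • 1 + U) - Ring.inverse (l • 1 + V)) := by
  rw [hV.cfc_log_eq_integral, hU.cfc_log_eq_integral,
    ← integral_sub hV.integrableOn_algebraMap_sub_inverse hU.integrableOn_algebraMap_sub_inverse]
  simp_rw [sub_sub_sub_cancel_left]
end

section
/- Let f : (0,∞) → ℝ admit the representation f(t) = a + b·t + ∫₀^∞ (tλ)/(t+λ) dw(λ) for all t > 0, where a ∈ ℝ, b ≥ 0 and w is a positive measure on (0,∞) with ∫₀^∞ λ/(1+λ) dw(λ) < ∞, and let f̃(t) := t·f(1/t). Then for all strictly positive operators U, V on a complex Hilbert space H, f̃(V) − f̃(U) = a(V − U) + ∫₀^∞ [ (I + λU)⁻¹ − (I + λV)⁻¹ ] dw(λ), where f̃(U), f̃(V) are defined by the continuous functional calculus. -/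
open MeasureTheory

variable {H : Type*} [NormedAddCommGroup H] [InnerProductSpace ℂ H] [CompleteSpace H]

/-- The real spectrum of a strictly positive operator consists of positive reals bounded by the
norm. -/
lemma StrictlyPos.mem_Ioc_of_mem_spectrum {T : H →L[ℂ] H} (hT : StrictlyPos T) {x : ℝ}
    (hx : x ∈ spectrum ℝ T) : x ∈ Set.Ioc 0 ‖T‖ := by
  have h0 : 0 ≤ x :=
    spectrum_nonneg_of_nonneg ((ContinuousLinearMap.nonneg_iff_isPositive T).2 hT.1) hx
  have hne : x ≠ 0 := by
    rintro rfl
    exact spectrum.zero_notMem ℝ hT.2 hx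
  refine ⟨lt_of_le_of_ne h0 hne.symm, (le_abs_self x).trans ?_⟩
  exact IsometricContinuousFunctionalCalculus.norm_spectrum_le T hx hT.1.isSelfAdjoint

/-- The operator `1 - (1 + l T)⁻¹` as a continuous function of `T`. -/
lemma StrictlyPos.cfc_one_sub_inv {T : H →L[ℂ] H} (hT : StrictlyPos T) {l : ℝ} (hl : 0 < l) :
    cfc (fun x : ℝ => 1 - (1 + l * x)⁻¹) T = 1 - Ring.inverse (1 + l • T) := by
  have hsa : IsSelfAdjoint T := hT.1.isSelfAdjoint
  have hne : ∀ x ∈ spectrum ℝ T, 1 + l * x ≠ 0 := fun x hx => by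
    have := mul_pos hl (hT.mem_Ioc_of_mem_spectrum hx).1
    positivity
  have hlin : ContinuousOn (fun x : ℝ => 1 + l * x) (spectrum ℝ T) := by fun_prop
  rw [cfc_sub (fun _ : ℝ => (1 : ℝ)) (fun x : ℝ => (1 + l * x)⁻¹) T (by fun_prop)
      (hlin.inv₀ hne), cfc_const_one ℝ T, cfc_inv (fun x : ℝ => 1 + l * x) T hne hlin,
    cfc_add T (fun _ : ℝ => (1 : ℝ)) (fun x : ℝ => l * x), cfc_const_one ℝ T,
    cfc_const_mul_id l T]

lemma StrictlyPos.continuousOn_one_sub_inv {T : H →L[ℂ] H} (hT : StrictlyPos T) :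
    ContinuousOn (Function.uncurry fun l x : ℝ => 1 - (1 + l * x)⁻¹)
      (Set.Ioi 0 ×ˢ spectrum ℝ T) := by
  refine continuousOn_const.sub (ContinuousOn.inv₀ (by fun_prop) ?_)
  rintro ⟨l, x⟩ ⟨hl, hx⟩
  have := mul_pos (Set.mem_Ioi.1 hl) (hT.mem_Ioc_of_mem_spectrum hx).1
  positivity

lemma StrictlyPos.norm_one_sub_inv_le {T : H →L[ℂ] H} (hT : StrictlyPos T) (w : Measure ℝ) :
    ∀ᵐ l ∂(w.restrict (Set.Ioi 0)), ∀ x ∈ spectrum ℝ T,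
      ‖1 - (1 + l * x)⁻¹‖ ≤ (1 + ‖T‖) * (l / (1 + l)) := by
  refine ae_restrict_of_forall_mem measurableSet_Ioi fun l hl x hx => ?_
  obtain ⟨hx0, hxT⟩ := hT.mem_Ioc_of_mem_spectrum hx
  have hl : 0 < l := hl
  have hlx := mul_pos hl hx0
  have h : 1 - (1 + l * x)⁻¹ = l * x / (1 + l * x) := by field_simp; ring
  rw [h, Real.norm_of_nonneg (by positivity), ← mul_div_assoc,
    div_le_div_iff₀ (by positivity) (by positivity)]
  have h1 : 0 ≤ l * (‖T‖ - x) := mul_nonneg hl.le (sub_nonneg.2 hxT)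
  have h2 : 0 ≤ l * (‖T‖ * (l * x)) := by positivity
  nlinarith

lemma StrictlyPos.integrableOn_one_sub_inverse {T : H →L[ℂ] H} (hT : StrictlyPos T) {w : Measure ℝ}
    (hw : IntegrableOn (fun l => l / (1 + l)) (Set.Ioi 0) w) :
    IntegrableOn (fun l : ℝ => 1 - Ring.inverse (1 + l • T)) (Set.Ioi 0) w := by
  have hsa : IsSelfAdjoint T := hT.1.isSelfAdjoint
  refine (integrableOn_cfc measurableSet_Ioi (fun l x : ℝ => 1 - (1 + l * x)⁻¹)
    (fun l => (1 + ‖T‖) * (l / (1 + l))) T hT.continuousOn_one_sub_inv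
    (hT.norm_one_sub_inv_le w) (hw.const_mul _).2 hsa).congr_fun (fun l hl => ?_) measurableSet_Ioi
  exact hT.cfc_one_sub_inv hl

lemma StrictlyPos.cfc_integral_one_sub_inv {T : H →L[ℂ] H} (hT : StrictlyPos T) {w : Measure ℝ}
    (hw : IntegrableOn (fun l => l / (1 + l)) (Set.Ioi 0) w) :
    cfc (fun x : ℝ => ∫ l in Set.Ioi 0, (1 - (1 + l * x)⁻¹) ∂w) T =
      ∫ l in Set.Ioi (0 : ℝ), (1 - Ring.inverse (1 + l • T)) ∂w := by
  have hsa : IsSelfAdjoint T := hT.1.isSelfAdjoint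
  rw [cfc_setIntegral measurableSet_Ioi (fun l x : ℝ => 1 - (1 + l * x)⁻¹)
    (fun l => (1 + ‖T‖) * (l / (1 + l))) T hT.continuousOn_one_sub_inv
    (hT.norm_one_sub_inv_le w) (hw.const_mul _).2 hsa]
  exact setIntegral_congr_fun measurableSet_Ioi fun l hl => hT.cfc_one_sub_inv hl

/-- Integral representation of the transpose of `f` at a strictly positive operator. -/
lemma StrictlyPos.cfc_transpose {T : H →L[ℂ] H} (hT : StrictlyPos T) {w : Measure ℝ}
    (hw : IntegrableOn (fun l => l / (1 + l)) (Set.Ioi 0) w)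
    {f : ℝ → ℝ} {a b : ℝ} (hf : ContinuousOn f (Set.Ioi 0))
    (hrep : ∀ t > (0:ℝ), f t = a + b * t + ∫ l in Set.Ioi 0, t * l / (t + l) ∂w) :
    cfc (fun t : ℝ => t * f t⁻¹) T = a • T + algebraMap ℝ (H →L[ℂ] H) b +
      ∫ l in Set.Ioi (0 : ℝ), (1 - Ring.inverse (1 + l • T)) ∂w := by
  have hsa : IsSelfAdjoint T := hT.1.isSelfAdjoint
  have hpos : ∀ x ∈ spectrum ℝ T, 0 < x := fun x hx => (hT.mem_Ioc_of_mem_spectrum hx).1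
  have hcont : ContinuousOn (fun t : ℝ => t * f t⁻¹) (spectrum ℝ T) := by
    refine continuousOn_id.mul (hf.comp (continuousOn_id.inv₀ fun x hx => (hpos x hx).ne') ?_)
    exact fun x hx => inv_pos.2 (hpos x hx)
  have key : (spectrum ℝ T).EqOn (fun x : ℝ => ∫ l in Set.Ioi 0, (1 - (1 + l * x)⁻¹) ∂w)
      (fun t : ℝ => t * f t⁻¹ - (a * t + b)) := by
    intro x hx
    have hx0 := hpos x hx
    have hI : ∫ l in Set.Ioi 0, (1 - (1 + l * x)⁻¹) ∂w =
        x * ∫ l in Set.Ioi 0, x⁻¹ * l / (x⁻¹ + l) ∂w := by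
      rw [← integral_const_mul]
      refine setIntegral_congr_fun measurableSet_Ioi fun l hl => ?_
      have hl : 0 < l := hl
      field_simp
      ring
    simp only [hI, hrep x⁻¹ (inv_pos.2 hx0)]
    field_simp
    ring
  rw [← hT.cfc_integral_one_sub_inv hw, cfc_congr key,
    cfc_sub (fun t : ℝ => t * f t⁻¹) (fun t => a * t + b) T hcont (by fun_prop),
    cfc_add T (fun t : ℝ => a * t) (fun _ => b), cfc_const_mul_id a T, cfc_const b T]
  abel

/-- **(2.10.a).** If `f(t) = a + b t + ∫₀^∞ tλ/(t+λ) dw(λ)` on `(0,∞)` and `f̃(t) = t f(1/t)`,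
then for all strictly positive operators `U, V`,
`f̃(V) - f̃(U) = a(V - U) + ∫₀^∞ [(I + λU)⁻¹ - (I + λV)⁻¹] dw(λ)`. -/
theorem stmt_18 (f : ℝ → ℝ) (a b : ℝ) (hb : 0 ≤ b) (w : Measure ℝ)
    (hf : ContinuousOn f (Set.Ioi 0))
    (hw : IntegrableOn (fun l => l / (1 + l)) (Set.Ioi 0) w)
    (hrep : ∀ t > (0:ℝ), f t = a + b * t + ∫ l in Set.Ioi 0, t * l / (t + l) ∂w)
    (U V : H →L[ℂ] H) (hU : StrictlyPos U) (hV : StrictlyPos V) :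
    cfc (fun t : ℝ => t * f t⁻¹) V - cfc (fun t : ℝ => t * f t⁻¹) U = a • (V - U) +
      ∫ l in Set.Ioi (0:ℝ), (Ring.inverse (1 + l • U) - Ring.inverse (1 + l • V)) ∂w := by
  rw [hV.cfc_transpose hw hf hrep, hU.cfc_transpose hw hf hrep]
  have h := integral_sub (hV.integrableOn_one_sub_inverse hw) (hU.integrableOn_one_sub_inverse hw)
  simp only [sub_sub_sub_cancel_left] at h
  rw [h, smul_sub]
  abel
end

section
/- Let f : (0,∞) → ℝ be nonnegative and admit the representation f(t) = a + b·t + ∫₀^∞ (tλ)/(t+λ) dw(λ) for all t > 0, where a ∈ ℝ, b ≥ 0 and w is a positive measure on (0,∞) with ∫₀^∞ λ/(1+λ) dw(λ) < ∞. Then a ≥ 0, and for all strictly positive operators A, B, P on a complex Hilbert space H with B ≥ A, 𝒫_f(P,B) − 𝒫_f(P,A) ≥ a(B − A) ≥ 0. -/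
open MeasureTheory

variable {H : Type*} [NormedAddCommGroup H] [InnerProductSpace ℂ H] [CompleteSpace H]

section Scalar

lemma mul_div_add_le_mul_div_one_add {M t l : ℝ} (ht : 0 < t) (hl : 0 < l) (hM : 1 ≤ M) (htM : t ≤ M) :
    t * l / (t + l) ≤ M * (l / (1 + l)) := by
  rw [← mul_div_assoc, div_le_div_iff₀ (by positivity) (by positivity)]
  have : t * (1 + l) ≤ M * (t + l) := by nlinarith
  nlinarith

lemma tendsto_integral_mul_div_add_nhdsGT_zero {w : Measure ℝ}
    (hw : IntegrableOn (fun l => l / (1 + l)) (Set.Ioi 0) w) :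
    Filter.Tendsto (fun t : ℝ => ∫ l in Set.Ioi 0, t * l / (t + l) ∂w)
      (nhdsWithin 0 (Set.Ioi 0)) (nhds 0) := by
  have hlim : Filter.Tendsto (fun t : ℝ => ∫ l in Set.Ioi 0, t * l / (t + l) ∂w)
      (nhdsWithin 0 (Set.Ioi 0)) (nhds (∫ _ in Set.Ioi (0 : ℝ), (0 : ℝ) ∂w)) := by
    refine tendsto_integral_filter_of_dominated_convergence (fun l => l / (1 + l)) ?_ ?_ hw ?_
    · exact .of_forall fun t => (by fun_prop : Measurable fun l : ℝ => t * l / (t + l)).aestronglyMeasurable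
    · filter_upwards [Ioc_mem_nhdsGT (zero_lt_one (α := ℝ))] with t ht
      refine ae_restrict_of_forall_mem measurableSet_Ioi fun l (hl : 0 < l) => ?_
      have ht0 := ht.1
      rw [Real.norm_of_nonneg (by positivity)]
      simpa using mul_div_add_le_mul_div_one_add ht.1 hl le_rfl ht.2
    · refine ae_restrict_of_forall_mem measurableSet_Ioi fun l (hl : 0 < l) => ?_
      have hc : ContinuousAt (fun t : ℝ => t * l / (t + l)) 0 := by
        refine ContinuousAt.div (by fun_prop) (by fun_prop) (by simpa using hl.ne')
      simpa using hc.tendsto.mono_left nhdsWithin_le_nhds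
  simpa using hlim

end Scalar

section CStarAlgebra

variable {𝔄 : Type*} [CStarAlgebra 𝔄] [PartialOrder 𝔄] [StarOrderedRing 𝔄]

/-- Scaled parallel sums are monotone. -/
lemma ringInverse_smul_add_mono {A B P : 𝔄} (hA : IsStrictlyPositive A)
    (hP : IsStrictlyPositive P) (hAB : A ≤ B) {r : ℝ} (hr : 0 < r) :
    Ring.inverse (r • Ring.inverse A + Ring.inverse P) ≤
      Ring.inverse (r • Ring.inverse B + Ring.inverse P) := by
  have hB := hA.of_le hAB
  refine CStarAlgebra.ringInverse_le_ringInverse ?_ ?_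
  · gcongr
  · exact (hB.ringInverse.smul hr).add_nonneg hP.ringInverse.nonneg

/-- The perspective of `t ↦ tl/(t+l)` is a scaled parallel sum. -/
lemma conj_cfc_mul_div_add {s i P : 𝔄} (hsi : s * i = 1) (his : i * s = 1)
    (hT : IsStrictlyPositive (i * P * i)) {l : ℝ} (hl : 0 < l) :
    s * cfc (fun t : ℝ => t * l / (t + l)) (i * P * i) * s =
      Ring.inverse (l⁻¹ • Ring.inverse (s * s) + Ring.inverse P) := by
  have hi : IsUnit i := ⟨⟨i, s, his, hsi⟩, rfl⟩
  have hs : IsUnit s := ⟨⟨s, i, hsi, his⟩, rfl⟩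
  have hsinv : Ring.inverse s = i := Ring.inverse_unit ⟨s, i, hsi, his⟩
  have hiinv : Ring.inverse i = s := Ring.inverse_unit ⟨i, s, his, hsi⟩
  have hTinv : Ring.inverse (i * P * i) = s * Ring.inverse P * s := by
    rw [Ring.inverse_mul (.inr hi), Ring.inverse_mul (.inl hi), hiinv, mul_assoc]
  have hpos := (StarOrderedRing.isStrictlyPositive_iff_spectrum_pos (R := ℝ) (i * P * i)
    hT.isSelfAdjoint).1 hT
  have hsa : IsSelfAdjoint (i * P * i) := hT.isSelfAdjoint
  have hcont : ContinuousOn (fun t : ℝ => t⁻¹) (spectrum ℝ (i * P * i)) :=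
    continuousOn_inv₀.mono fun t ht => (hpos t ht).ne'
  have hcfc : cfc (fun t : ℝ => t * l / (t + l)) (i * P * i) =
      Ring.inverse (algebraMap ℝ 𝔄 l⁻¹ + s * Ring.inverse P * s) := by
    have hinv := cfc_inv (R := ℝ) id (i * P * i) (fun t ht => (hpos t ht).ne')
      continuousOn_id hsa
    rw [cfc_id ℝ _ hsa, hTinv] at hinv
    simp only [id] at hinv
    rw [← hinv, ← cfc_const_add l⁻¹ _ _ hcont hsa, ← cfc_inv _ _ _ (by fun_prop) hsa]
    · refine cfc_congr fun t ht => ?_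
      have := hpos t ht
      field_simp
    · intro t ht
      have := hpos t ht
      positivity
  have hsum : l⁻¹ • Ring.inverse (s * s) + Ring.inverse P =
      i * (algebraMap ℝ 𝔄 l⁻¹ + s * Ring.inverse P * s) * i := by
    have hcancel : i * (s * Ring.inverse P * s) * i = Ring.inverse P := by
      rw [show i * (s * Ring.inverse P * s) * i = (i * s) * Ring.inverse P * (s * i) by
        simp only [mul_assoc], his, hsi, one_mul, mul_one]
    rw [mul_add, add_mul, hcancel, Ring.inverse_mul (.inl hs), hsinv,
      Algebra.algebraMap_eq_smul_one, mul_smul_comm, mul_one, smul_mul_assoc]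
  rw [hsum, Ring.inverse_mul (.inr hi), Ring.inverse_mul (.inl hi), hiinv, hcfc, mul_assoc]

/-- Integral representation of the perspective, written with `s = A^{1/2}` and `i = A^{-1/2}`. -/
lemma integrableOn_and_conj_cfc_eq {f : ℝ → ℝ} {a b : ℝ} {w : Measure ℝ}
    (hw : IntegrableOn (fun l => l / (1 + l)) (Set.Ioi 0) w)
    (hrep : ∀ t > (0 : ℝ), f t = a + b * t + ∫ l in Set.Ioi 0, t * l / (t + l) ∂w)
    (hf : ContinuousOn f (Set.Ioi 0))
    {s i P : 𝔄} (hsi : s * i = 1) (his : i * s = 1)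
    (hT : IsStrictlyPositive (i * P * i)) :
    IntegrableOn (fun l : ℝ => Ring.inverse (l⁻¹ • Ring.inverse (s * s) + Ring.inverse P))
      (Set.Ioi 0) w ∧
    s * cfc f (i * P * i) * s = a • (s * s) + b • P +
      ∫ l in Set.Ioi 0, Ring.inverse (l⁻¹ • Ring.inverse (s * s) + Ring.inverse P) ∂w := by
  have hpos := (StarOrderedRing.isStrictlyPositive_iff_spectrum_pos (R := ℝ) (i * P * i)
    hT.isSelfAdjoint).1 hT
  have hsa : IsSelfAdjoint (i * P * i) := hT.isSelfAdjoint
  obtain ⟨M, hM⟩ := (ContinuousFunctionalCalculus.isCompact_spectrum (R := ℝ)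
    (i * P * i)).bddAbove
  have hjoint : ContinuousOn (Function.uncurry fun l t : ℝ => t * l / (t + l))
      (Set.Ioi 0 ×ˢ spectrum ℝ (i * P * i)) := by
    refine ContinuousOn.div (by fun_prop) (by fun_prop) fun p hp => ?_
    have h1 : 0 < p.1 := hp.1
    have h2 := hpos _ hp.2
    positivity
  have hbound : ∀ᵐ l ∂(w.restrict (Set.Ioi 0)), ∀ t ∈ spectrum ℝ (i * P * i),
      ‖t * l / (t + l)‖ ≤ max 1 M * (l / (1 + l)) := by
    refine ae_restrict_of_forall_mem measurableSet_Ioi fun l (hl : 0 < l) t ht => ?_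
    have ht0 := hpos t ht
    rw [Real.norm_of_nonneg (by positivity)]
    exact mul_div_add_le_mul_div_one_add ht0 hl (le_max_left _ _) ((hM ht).trans (le_max_right _ _))
  have hfin := (hw.const_mul (max 1 M)).hasFiniteIntegral
  have hint := integrableOn_cfc measurableSet_Ioi _ _ (i * P * i) hjoint hbound hfin hsa
  have hcfc := cfc_setIntegral measurableSet_Ioi _ _ (i * P * i) hjoint hbound hfin hsa
  let L : 𝔄 →L[ℝ] 𝔄 := (ContinuousLinearMap.mul ℝ 𝔄).flip s ∘L ContinuousLinearMap.mul ℝ 𝔄 s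
  have hL : ∀ x, L x = s * x * s := fun x => rfl
  have hLeq : Set.EqOn (fun l : ℝ => L (cfc (fun t : ℝ => t * l / (t + l)) (i * P * i)))
      (fun l : ℝ => Ring.inverse (l⁻¹ • Ring.inverse (s * s) + Ring.inverse P)) (Set.Ioi 0) :=
    fun l hl => conj_cfc_mul_div_add hsi his hT hl
  refine ⟨(integrableOn_congr_fun hLeq measurableSet_Ioi).1 (L.integrable_comp hint), ?_⟩
  have hfcont : ContinuousOn f (spectrum ℝ (i * P * i)) := hf.mono hpos
  have hgcont : ContinuousOn (fun t : ℝ => ∫ l in Set.Ioi 0, t * l / (t + l) ∂w)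
      (spectrum ℝ (i * P * i)) := by
    refine (hfcont.sub (by fun_prop : ContinuousOn (fun t : ℝ => a + b * t) _)).congr
      fun t ht => ?_
    simp [hrep t (hpos t ht)]
  have hsplit : cfc f (i * P * i) = algebraMap ℝ 𝔄 a + b • (i * P * i) +
      ∫ l in Set.Ioi 0, cfc (fun t : ℝ => t * l / (t + l)) (i * P * i) ∂w := by
    rw [← hcfc, ← cfc_const_mul_id b _ hsa, ← cfc_const_add a _ _ (by fun_prop) hsa,
      ← cfc_add _ _ _ (by fun_prop) hgcont]
    exact cfc_congr fun t ht => hrep t (hpos t ht)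
  have hcancel : s * (i * P * i) * s = P := by
    rw [show s * (i * P * i) * s = (s * i) * P * (i * s) by simp only [mul_assoc],
      hsi, his, one_mul, mul_one]
  rw [← setIntegral_congr_fun measurableSet_Ioi hLeq, L.integral_comp_comm hint, hL, hsplit,
    mul_add, add_mul, mul_add, add_mul, mul_smul_comm, smul_mul_assoc, hcancel,
    Algebra.algebraMap_eq_smul_one, mul_smul_comm, mul_one, smul_mul_assoc]

end CStarAlgebra

lemma StrictlyPos.isStrictlyPositive {T : H →L[ℂ] H} (hT : StrictlyPos T) :
    IsStrictlyPositive T :=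
  ⟨T.nonneg_iff_isPositive.2 hT.1, hT.2⟩

lemma isSelfAdjoint_opInvSqrt (A : H →L[ℂ] H) : IsSelfAdjoint (opInvSqrt A) :=
  cfc_predicate _ _

lemma opSqrt_mul_self {A : H →L[ℂ] H} (hA : StrictlyPos A) : opSqrt A * opSqrt A = A := by
  have hA' := hA.isStrictlyPositive
  have hpos := (StarOrderedRing.isStrictlyPositive_iff_spectrum_pos (R := ℝ) A
    hA'.isSelfAdjoint).1 hA'
  rw [opSqrt, ← cfc_mul _ _ _ (by fun_prop) (by fun_prop)]
  conv_rhs => rw [← cfc_id ℝ A hA'.isSelfAdjoint]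
  exact cfc_congr fun t ht => Real.mul_self_sqrt (hpos t ht).le

lemma opSqrt_mul_opInvSqrt {A : H →L[ℂ] H} (hA : StrictlyPos A) :
    opSqrt A * opInvSqrt A = 1 ∧ opInvSqrt A * opSqrt A = 1 := by
  have hA' := hA.isStrictlyPositive
  have hsa : IsSelfAdjoint A := hA'.isSelfAdjoint
  have hpos := (StarOrderedRing.isStrictlyPositive_iff_spectrum_pos (R := ℝ) A hsa).1 hA'
  have hne : ∀ t ∈ spectrum ℝ A, √t ≠ 0 := fun t ht => (Real.sqrt_pos.2 (hpos t ht)).ne'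
  have hcont : ContinuousOn (fun t : ℝ => (√t)⁻¹) (spectrum ℝ A) :=
    Real.continuous_sqrt.continuousOn.inv₀ hne
  rw [opSqrt, opInvSqrt, ← cfc_mul _ _ _ (by fun_prop) hcont,
    ← cfc_mul _ _ _ hcont (by fun_prop), ← cfc_one ℝ A hsa]
  exact ⟨cfc_congr fun t ht => mul_inv_cancel₀ (hne t ht),
    cfc_congr fun t ht => inv_mul_cancel₀ (hne t ht)⟩

lemma integrableOn_and_persp_eq {f : ℝ → ℝ} {a b : ℝ} {w : Measure ℝ}
    (hw : IntegrableOn (fun l => l / (1 + l)) (Set.Ioi 0) w)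
    (hrep : ∀ t > (0 : ℝ), f t = a + b * t + ∫ l in Set.Ioi 0, t * l / (t + l) ∂w)
    (hf : ContinuousOn f (Set.Ioi 0)) {A P : H →L[ℂ] H}
    (hA : StrictlyPos A) (hP : StrictlyPos P) :
    IntegrableOn (fun l : ℝ => Ring.inverse (l⁻¹ • Ring.inverse A + Ring.inverse P))
      (Set.Ioi 0) w ∧
    persp f P A = a • A + b • P +
      ∫ l in Set.Ioi 0, Ring.inverse (l⁻¹ • Ring.inverse A + Ring.inverse P) ∂w := by
  obtain ⟨hsi, his⟩ := opSqrt_mul_opInvSqrt hA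
  have hT := hP.isStrictlyPositive.conjugate_of_isUnit_of_isSelfAdjoint P (opInvSqrt A)
    ⟨⟨_, _, his, hsi⟩, rfl⟩ (isSelfAdjoint_opInvSqrt A)
  have h := integrableOn_and_conj_cfc_eq hw hrep hf hsi his hT
  rwa [opSqrt_mul_self hA] at h

/-- **Remark 2.1.** If `f` is nonnegative and `f(t) = a + b t + ∫₀^∞ tλ/(t+λ) dw(λ)` on
`(0,∞)`, then `a ≥ 0`, and if `B ≥ A > 0`, `P > 0`, then
`𝒫_f(P,B) - 𝒫_f(P,A) ≥ a(B - A) ≥ 0`. -/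
theorem stmt_19 (f : ℝ → ℝ) (a b : ℝ) (hb : 0 ≤ b) (w : Measure ℝ)
    (hf : ContinuousOn f (Set.Ioi 0)) (hfnn : ∀ t > (0:ℝ), 0 ≤ f t)
    (hw : IntegrableOn (fun l => l / (1 + l)) (Set.Ioi 0) w)
    (hrep : ∀ t > (0:ℝ), f t = a + b * t + ∫ l in Set.Ioi 0, t * l / (t + l) ∂w)
    (A B P : H →L[ℂ] H) (hA : StrictlyPos A) (hB : StrictlyPos B) (hP : StrictlyPos P)
    (hBA : (B - A).IsPositive) :
    0 ≤ a ∧ (persp f P B - persp f P A - a • (B - A)).IsPositive ∧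
      (a • (B - A)).IsPositive := by
  have ha : 0 ≤ a := by
    have hlim : Filter.Tendsto f (nhdsWithin 0 (Set.Ioi 0)) (nhds a) := by
      have hlin : Filter.Tendsto (fun t : ℝ => a + b * t) (nhdsWithin 0 (Set.Ioi 0))
          (nhds a) := by
        have hc : ContinuousAt (fun t : ℝ => a + b * t) 0 := by fun_prop
        simpa using hc.tendsto.mono_left nhdsWithin_le_nhds
      refine Filter.Tendsto.congr' ?_
        (by simpa using hlin.add (tendsto_integral_mul_div_add_nhdsGT_zero hw))
      filter_upwards [self_mem_nhdsWithin] with t ht using (hrep t ht).symm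
    exact ge_of_tendsto hlim (by filter_upwards [self_mem_nhdsWithin] with t ht using hfnn t ht)
  have hAB : A ≤ B := hBA
  refine ⟨ha, ?_, ?_⟩
  · obtain ⟨hiA, heA⟩ := integrableOn_and_persp_eq hw hrep hf hA hP
    obtain ⟨hiB, heB⟩ := integrableOn_and_persp_eq hw hrep hf hB hP
    have hmono := setIntegral_mono_on hiA hiB measurableSet_Ioi fun l (hl : 0 < l) =>
      ringInverse_smul_add_mono hA.isStrictlyPositive hP.isStrictlyPositive hAB (inv_pos.2 hl)
    rw [← ContinuousLinearMap.nonneg_iff_isPositive, heA, heB, smul_sub]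
    convert! sub_nonneg.2 hmono using 1
    abel
  · rw [← ContinuousLinearMap.nonneg_iff_isPositive]
    exact smul_nonneg ha (sub_nonneg.2 hAB)
end
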